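/- arXiv:math-ph/0511035 — 8 statements merged into one kernel-verified Lean document; each statement's English description precedes it below -/
import Mathlib

section
/- Let H : ℝ → ℝ be twice continuously differentiable and let u, ζ, φ : ℝ² → ℝ be smooth functions of (t,x). Define the linearized operator M (the Fréchet derivative of the expression e^x[u_tt + H'(u_x)u_xx + H(u_x)] about u) by Mζ = e^x(ζ_tt + H'(u_x)ζ_xx + (H''(u_x)u_xx + H'(u_x))ζ_x). Then the identity φ·Mζ − ζ·Mφ = D_t[e^x(φ·ζ_t − ζ·φ_t)] + D_x[e^x·H'(u_x)·(φ·ζ_x − ζ·φ_x)] holds at every point of ℝ²; i.e., the linearization of the PDE e^x[u_tt + H'(u_x)u_xx + H(u_x)] = 0 is self-adjoint. -/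
noncomputable section

/-- Partial derivative with respect to `t` of a function of `(t,x)`. -/
def Dt (w : ℝ → ℝ → ℝ) (t x : ℝ) : ℝ := deriv (fun s => w s x) t

/-- Partial derivative with respect to `x` of a function of `(t,x)`. -/
def Dx (w : ℝ → ℝ → ℝ) (t x : ℝ) : ℝ := deriv (fun s => w t s) x

/-- The linearized operator (Fréchet derivative) of the expression
`e^x (u_tt + H'(u_x) u_xx + H(u_x))` about `u`, applied to `w`:
`M w = e^x (w_tt + H'(u_x) w_xx + (H''(u_x) u_xx + H'(u_x)) w_x)`. -/
def M (H : ℝ → ℝ) (u w : ℝ → ℝ → ℝ) (t x : ℝ) : ℝ :=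
  Real.exp x * (Dt (Dt w) t x + deriv H (Dx u t x) * Dx (Dx w) t x +
    (deriv (deriv H) (Dx u t x) * Dx (Dx u) t x + deriv H (Dx u t x)) * Dx w t x)

/-- The `t`-slices of a smooth function of `(t,x)` are smooth. -/
lemma contDiff_slice_t {w : ℝ → ℝ → ℝ} (hw : ContDiff ℝ (⊤ : ℕ∞) fun p : ℝ × ℝ => w p.1 p.2)
    (x : ℝ) : ContDiff ℝ (⊤ : ℕ∞) fun s => w s x :=
  hw.comp (contDiff_id.prodMk contDiff_const)

/-- The `x`-slices of a smooth function of `(t,x)` are smooth. -/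
lemma contDiff_slice_x {w : ℝ → ℝ → ℝ} (hw : ContDiff ℝ (⊤ : ℕ∞) fun p : ℝ × ℝ => w p.1 p.2)
    (t : ℝ) : ContDiff ℝ (⊤ : ℕ∞) (w t) :=
  hw.comp (contDiff_const.prodMk contDiff_id)

/-- A smooth function of one variable and its derivative have derivatives everywhere. -/
lemma hasDerivAt_and_hasDerivAt_deriv {f : ℝ → ℝ} (hf : ContDiff ℝ (⊤ : ℕ∞) f) (s : ℝ) :
    HasDerivAt f (deriv f s) s ∧ HasDerivAt (deriv f) (deriv (deriv f) s) s :=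
  ⟨(hf.differentiable (by simp) s).hasDerivAt,
    ((contDiff_infty_iff_deriv.1 hf).2.differentiable (by simp) s).hasDerivAt⟩

/- STATEMENT 1: the linearization of `e^x [u_tt + H'(u_x)u_xx + H(u_x)] = 0`
   is self-adjoint. -/
theorem stmt1 (H : ℝ → ℝ) (hH : ContDiff ℝ 2 H) (u ζ φ : ℝ → ℝ → ℝ)
    (hu : ContDiff ℝ (⊤ : ℕ∞) fun p : ℝ × ℝ => u p.1 p.2)
    (hζ : ContDiff ℝ (⊤ : ℕ∞) fun p : ℝ × ℝ => ζ p.1 p.2)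
    (hφ : ContDiff ℝ (⊤ : ℕ∞) fun p : ℝ × ℝ => φ p.1 p.2) :
    ∀ t x : ℝ,
      φ t x * M H u ζ t x - ζ t x * M H u φ t x =
        Dt (fun t x => Real.exp x * (φ t x * Dt ζ t x - ζ t x * Dt φ t x)) t x +
        Dx (fun t x => Real.exp x * deriv H (Dx u t x) *
          (φ t x * Dx ζ t x - ζ t x * Dx φ t x)) t x := by
  intro t x
  have hH' : HasDerivAt (deriv H) (deriv (deriv H) (Dx u t x)) (Dx u t x) :=
    (((contDiff_succ_iff_deriv (n := 1)).1 hH).2.2.differentiable (by simp) _).hasDerivAt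
  obtain ⟨-, hux⟩ := hasDerivAt_and_hasDerivAt_deriv (contDiff_slice_x hu t) x
  obtain ⟨hζx, hζxx⟩ := hasDerivAt_and_hasDerivAt_deriv (contDiff_slice_x hζ t) x
  obtain ⟨hφx, hφxx⟩ := hasDerivAt_and_hasDerivAt_deriv (contDiff_slice_x hφ t) x
  obtain ⟨hζt, hζtt⟩ := hasDerivAt_and_hasDerivAt_deriv (contDiff_slice_t hζ x) t
  obtain ⟨hφt, hφtt⟩ := hasDerivAt_and_hasDerivAt_deriv (contDiff_slice_t hφ x) t
  have ht := (((hφt.mul hζtt).sub (hζt.mul hφtt)).const_mul (Real.exp x)).deriv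
  have hx := (((Real.hasDerivAt_exp x).mul (hH'.comp x hux)).mul
    ((hφx.mul hζxx).sub (hζx.mul hφxx))).deriv
  refine Eq.trans ?_ (congrArg₂ (· + ·) ht hx).symm
  simp only [M, Dt, Dx, Function.comp_apply, Pi.mul_apply, Pi.sub_apply]
  ring
end
end

section
/- Let u, v : ℝ² → ℝ be smooth functions of (t,x). Define θ(x,t) = ½(v + (x + 2e^u)/√2) and E(x,t) = e^{−½(u + t/√2)} (with u = u(t,x), v = v(t,x)). Define the multipliers α = E·sin θ, β = −E·(√2·e^u·sin θ + cos θ) and the densities T = −2E·cos θ, X = 2E·(√2·e^u·cos θ − sin θ). Then the identity α·(v_t + (1 − 2e^{2u})u_x − e^u) + β·(v_x − u_t) = D_t T + D_x X holds at every point of ℝ²; i.e., (α,β) are multipliers yielding the conservation law with conserved densities (T,X) for the nonlinear telegraph potential system v_t + (1 − 2e^{2u})u_x − e^u = 0, v_x − u_t = 0. -/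
noncomputable section

/-- `θ(x,t) = ½ (v + (x + 2 e^u)/√2)`. -/
def theta (u v : ℝ → ℝ → ℝ) (t x : ℝ) : ℝ :=
  (1 / 2) * (v t x + (x + 2 * Real.exp (u t x)) / Real.sqrt 2)

/-- `E(x,t) = e^{−½(u + t/√2)}`. -/
def Efn (u : ℝ → ℝ → ℝ) (t x : ℝ) : ℝ :=
  Real.exp (-(1 / 2) * (u t x + t / Real.sqrt 2))

theorem hasDerivAt_Dt {w : ℝ → ℝ → ℝ} (hw : Differentiable ℝ fun p : ℝ × ℝ => w p.1 p.2)
    (t x : ℝ) : HasDerivAt (fun s => w s x) (Dt w t x) t :=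
  (hw.comp (differentiable_id.prodMk (differentiable_const x)) t).hasDerivAt

theorem hasDerivAt_Dx {w : ℝ → ℝ → ℝ} (hw : Differentiable ℝ fun p : ℝ × ℝ => w p.1 p.2)
    (t x : ℝ) : HasDerivAt (fun s => w t s) (Dx w t x) x :=
  (hw.comp ((differentiable_const t).prodMk differentiable_id) x).hasDerivAt

theorem hasDerivAt_theta_t {u v : ℝ → ℝ → ℝ} {t x u' v' : ℝ}
    (hu : HasDerivAt (fun s => u s x) u' t) (hv : HasDerivAt (fun s => v s x) v' t) :
    HasDerivAt (fun s => theta u v s x)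
      ((1 / 2) * (v' + 2 * (Real.exp (u t x) * u') / Real.sqrt 2)) t :=
  (hv.add (((hu.exp.const_mul 2).const_add x).div_const _)).const_mul _

theorem hasDerivAt_theta_x {u v : ℝ → ℝ → ℝ} {t x u' v' : ℝ}
    (hu : HasDerivAt (fun s => u t s) u' x) (hv : HasDerivAt (fun s => v t s) v' x) :
    HasDerivAt (fun s => theta u v t s)
      ((1 / 2) * (v' + (1 + 2 * (Real.exp (u t x) * u')) / Real.sqrt 2)) x :=
  (hv.add (((hasDerivAt_id x).add (hu.exp.const_mul 2)).div_const _)).const_mul _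

theorem hasDerivAt_Efn_t {u : ℝ → ℝ → ℝ} {t x u' : ℝ}
    (hu : HasDerivAt (fun s => u s x) u' t) :
    HasDerivAt (fun s => Efn u s x)
      (Efn u t x * (-(1 / 2) * (u' + 1 / Real.sqrt 2))) t :=
  ((hu.add ((hasDerivAt_id t).div_const _)).const_mul _).exp

theorem hasDerivAt_Efn_x {u : ℝ → ℝ → ℝ} {t x u' : ℝ}
    (hu : HasDerivAt (fun s => u t s) u' x) :
    HasDerivAt (fun s => Efn u t s) (Efn u t x * (-(1 / 2) * u')) x :=
  ((hu.add_const _).const_mul _).exp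

/- STATEMENT 4: `(α,β) = (E sin θ, −E(√2 e^u sin θ + cos θ))` are multipliers
   yielding the conservation law with densities `(T,X)` for the NLT potential
   system `v_t + (1 − 2e^{2u})u_x − e^u = 0, v_x − u_t = 0`. -/
theorem stmt4 (u v : ℝ → ℝ → ℝ)
    (hu : ContDiff ℝ (⊤ : ℕ∞) fun p : ℝ × ℝ => u p.1 p.2)
    (hv : ContDiff ℝ (⊤ : ℕ∞) fun p : ℝ × ℝ => v p.1 p.2) :
    ∀ t x : ℝ,
      (Efn u t x * Real.sin (theta u v t x)) *
        (Dt v t x + (1 - 2 * Real.exp (2 * u t x)) * Dx u t x - Real.exp (u t x)) +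
      (-(Efn u t x * (Real.sqrt 2 * Real.exp (u t x) * Real.sin (theta u v t x) +
          Real.cos (theta u v t x)))) * (Dx v t x - Dt u t x) =
      Dt (fun t x => -2 * Efn u t x * Real.cos (theta u v t x)) t x +
      Dx (fun t x => 2 * Efn u t x * (Real.sqrt 2 * Real.exp (u t x) *
          Real.cos (theta u v t x) - Real.sin (theta u v t x))) t x := by
  intro t x
  have hu' := hu.differentiable (by simp)
  have hv' := hv.differentiable (by simp)
  have hut := hasDerivAt_Dt hu' t x
  have hux := hasDerivAt_Dx hu' t x
  have hθt := hasDerivAt_theta_t hut (hasDerivAt_Dt hv' t x)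
  have hθx := hasDerivAt_theta_x hux (hasDerivAt_Dx hv' t x)
  have hT : Dt (fun t x => -2 * Efn u t x * Real.cos (theta u v t x)) t x = _ :=
    (((hasDerivAt_Efn_t hut).const_mul (-2)).mul hθt.cos).deriv
  have hX : Dx (fun t x => 2 * Efn u t x * (Real.sqrt 2 * Real.exp (u t x) *
      Real.cos (theta u v t x) - Real.sin (theta u v t x))) t x = _ :=
    (((hasDerivAt_Efn_x hux).const_mul 2).mul
      (((hux.exp.const_mul (Real.sqrt 2)).mul hθx.cos).sub hθx.sin)).deriv
  have hexp : Real.exp (2 * u t x) = Real.exp (u t x) ^ 2 := by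
    rw [two_mul, Real.exp_add, sq]
  have hsq : Real.sqrt 2 ^ 2 = 2 := Real.sq_sqrt (by norm_num)
  have hinv : (Real.sqrt 2)⁻¹ = Real.sqrt 2 * 2⁻¹ := by
    field_simp
    exact hsq.symm
  rw [hT, hX, hexp]
  simp only [div_eq_mul_inv, hinv, Pi.sub_apply, Pi.mul_apply]
  linear_combination Efn u t x * Real.sin (theta u v t x) *
    (Real.exp (u t x) / 2 + Real.exp (u t x) ^ 2 * Dx u t x) * hsq
end
end

section
/- Let u, v : ℝ² → ℝ be smooth functions of (t,x). Define the multipliers α = e^x·(2x + t² − v² − 2·log(cosh u)), β = 2e^x·(v·tanh u − t) and the densities T = e^x·[2tu − v³/3 + v(t² + 2x − 2·log(cosh u))], X = e^x·[(v² − t² − 2x + 2(1 + log(cosh u)))·tanh u − 2(tv + u)]. Then the identity α·(v_t − (sech²u)·u_x − tanh u) + β·(v_x − u_t) = D_t T + D_x X holds at every point of ℝ²; i.e., (α,β) are multipliers yielding the conservation law with conserved densities (T,X) for the nonlinear telegraph potential system with F(u) = sech²u, G(u) = tanh u. -/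
noncomputable section

theorem hasDerivAt_tanh_comp {f : ℝ → ℝ} {f' a : ℝ} (hf : HasDerivAt f f' a) :
    HasDerivAt (fun s => Real.tanh (f s)) ((1 / Real.cosh (f a)) ^ 2 * f') a := by
  have hc := (Real.cosh_pos (f a)).ne'
  simp only [Real.tanh_eq_sinh_div_cosh]
  refine (hf.sinh.div hf.cosh hc).congr_deriv ?_
  field_simp
  linear_combination f' * Real.cosh_sq (f a)

theorem hasDerivAt_log_cosh_comp {f : ℝ → ℝ} {f' a : ℝ} (hf : HasDerivAt f f' a) :
    HasDerivAt (fun s => Real.log (Real.cosh (f s))) (Real.tanh (f a) * f') a := by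
  refine (hf.cosh.log (Real.cosh_pos (f a)).ne').congr_deriv ?_
  rw [Real.tanh_eq_sinh_div_cosh]
  ring

/- STATEMENT 5: `(α,β)` are multipliers yielding the conservation law with
   densities `(T,X)` for the NLT potential system with `F(u) = sech²u`,
   `G(u) = tanh u`. -/
theorem stmt5 (u v : ℝ → ℝ → ℝ)
    (hu : ContDiff ℝ (⊤ : ℕ∞) fun p : ℝ × ℝ => u p.1 p.2)
    (hv : ContDiff ℝ (⊤ : ℕ∞) fun p : ℝ × ℝ => v p.1 p.2) :
    ∀ t x : ℝ,
      (Real.exp x * (2 * x + t ^ 2 - (v t x) ^ 2 - 2 * Real.log (Real.cosh (u t x)))) *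
        (Dt v t x - (1 / Real.cosh (u t x)) ^ 2 * Dx u t x - Real.tanh (u t x)) +
      (2 * Real.exp x * (v t x * Real.tanh (u t x) - t)) * (Dx v t x - Dt u t x) =
      Dt (fun t x => Real.exp x * (2 * t * u t x - (v t x) ^ 3 / 3 +
          v t x * (t ^ 2 + 2 * x - 2 * Real.log (Real.cosh (u t x))))) t x +
      Dx (fun t x => Real.exp x * (((v t x) ^ 2 - t ^ 2 - 2 * x +
          2 * (1 + Real.log (Real.cosh (u t x)))) * Real.tanh (u t x) -
          2 * (t * v t x + u t x))) t x := by
  intro t x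
  have hu' := hu.differentiable (by simp)
  have hv' := hv.differentiable (by simp)
  have hut := hasDerivAt_Dt hu' t x
  have hux := hasDerivAt_Dx hu' t x
  have hvt := hasDerivAt_Dt hv' t x
  have hvx := hasDerivAt_Dx hv' t x
  have hT := ((((hasDerivAt_id' t).const_mul 2).mul hut).sub ((hvt.pow 3).div_const 3)).add
    (hvt.mul ((((hasDerivAt_id' t).pow 2).add_const (2 * x)).sub
      ((hasDerivAt_log_cosh_comp hut).const_mul 2))) |>.const_mul (Real.exp x)
  have hX := (Real.hasDerivAt_exp x).mul
    ((((((hvx.pow 2).sub_const (t ^ 2)).sub ((hasDerivAt_id' x).const_mul 2)).add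
      (((hasDerivAt_log_cosh_comp hux).const_add 1).const_mul 2)).mul
        (hasDerivAt_tanh_comp hux)).sub (((hvx.const_mul t).add hux).const_mul 2))
  have hsech : (1 / Real.cosh (u t x)) ^ 2 = 1 - Real.tanh (u t x) ^ 2 := by
    have hc := (Real.cosh_pos (u t x)).ne'
    rw [Real.tanh_eq_sinh_div_cosh]
    field_simp
    linear_combination -Real.cosh_sq (u t x)
  have hT' := hT.deriv
  have hX' := hX.deriv
  rw [hsech] at hX' ⊢
  refine Eq.trans ?_ (congrArg₂ (· + ·) hT' hX').symm
  simp only [Pi.add_apply, Pi.sub_apply, Pi.mul_apply, Pi.pow_apply]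
  push_cast
  ring
end
end

section
/- Let u, v : ℝ² → ℝ be smooth functions of (t,x). Define θ̃(x,t) = ½(−v + (x + 2e^u)/√2) and Ẽ(x,t) = e^{−½(u − t/√2)}. Define α₂ = −Ẽ·sin θ̃, β₂ = −Ẽ·(√2·e^u·sin θ̃ + cos θ̃), T₂ = −2Ẽ·cos θ̃, X₂ = −2Ẽ·(√2·e^u·cos θ̃ − sin θ̃) (these are the images of the multipliers and densities of the known conservation law under the reflection (t,v) ↦ (−t,−v)). Then the identity α₂·(v_t + (1 − 2e^{2u})u_x − e^u) + β₂·(v_x − u_t) = D_t T₂ + D_x X₂ holds at every point of ℝ²; i.e., the reflection symmetry applied to the known conservation law yields a second conservation law of the system v_t + (1 − 2e^{2u})u_x − e^u = 0, v_x − u_t = 0. -/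
noncomputable section

/-- `θ̃(x,t) = ½ (−v + (x + 2 e^u)/√2)`. -/
def thetaT (u v : ℝ → ℝ → ℝ) (t x : ℝ) : ℝ :=
  (1 / 2) * (-v t x + (x + 2 * Real.exp (u t x)) / Real.sqrt 2)

/-- `Ẽ(x,t) = e^{−½(u − t/√2)}`. -/
def EfnT (u : ℝ → ℝ → ℝ) (t x : ℝ) : ℝ :=
  Real.exp (-(1 / 2) * (u t x - t / Real.sqrt 2))

theorem hasDerivAt_fst_of_contDiff {w : ℝ → ℝ → ℝ}
    (hw : ContDiff ℝ (⊤ : ℕ∞) fun p : ℝ × ℝ => w p.1 p.2) (t x : ℝ) :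
    HasDerivAt (fun s => w s x) (Dt w t x) t := by
  have h : Differentiable ℝ fun p : ℝ × ℝ => w p.1 p.2 := hw.differentiable (by simp)
  have h' : Differentiable ℝ fun s => w s x :=
    h.comp (differentiable_id.prodMk (differentiable_const x))
  exact (h' t).hasDerivAt

theorem hasDerivAt_snd_of_contDiff {w : ℝ → ℝ → ℝ}
    (hw : ContDiff ℝ (⊤ : ℕ∞) fun p : ℝ × ℝ => w p.1 p.2) (t x : ℝ) :
    HasDerivAt (fun s => w t s) (Dx w t x) x := by
  have h : Differentiable ℝ fun p : ℝ × ℝ => w p.1 p.2 := hw.differentiable (by simp)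
  have h' : Differentiable ℝ fun s => w t s :=
    h.comp ((differentiable_const t).prodMk differentiable_id)
  exact (h' x).hasDerivAt

/- STATEMENT 10: the reflection symmetry `(t,v) ↦ (−t,−v)` applied to the known
   conservation law yields a second conservation law
   `α₂·G1 + β₂·G2 = D_t T₂ + D_x X₂` for the system
   `v_t + (1 − 2e^{2u})u_x − e^u = 0`, `v_x − u_t = 0`. -/
theorem stmt10 (u v : ℝ → ℝ → ℝ)
    (hu : ContDiff ℝ (⊤ : ℕ∞) fun p : ℝ × ℝ => u p.1 p.2)
    (hv : ContDiff ℝ (⊤ : ℕ∞) fun p : ℝ × ℝ => v p.1 p.2) :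
    ∀ t x : ℝ,
      (-(EfnT u t x * Real.sin (thetaT u v t x))) *
        (Dt v t x + (1 - 2 * Real.exp (2 * u t x)) * Dx u t x - Real.exp (u t x)) +
      (-(EfnT u t x * (Real.sqrt 2 * Real.exp (u t x) * Real.sin (thetaT u v t x) +
          Real.cos (thetaT u v t x)))) * (Dx v t x - Dt u t x) =
      Dt (fun t x => -2 * EfnT u t x * Real.cos (thetaT u v t x)) t x +
      Dx (fun t x => -2 * EfnT u t x * (Real.sqrt 2 * Real.exp (u t x) *
          Real.cos (thetaT u v t x) - Real.sin (thetaT u v t x))) t x := by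
  intro t x
  have hut := hasDerivAt_fst_of_contDiff hu t x
  have hux := hasDerivAt_snd_of_contDiff hu t x
  have hvt := hasDerivAt_fst_of_contDiff hv t x
  have hvx := hasDerivAt_snd_of_contDiff hv t x
  have hEt : HasDerivAt (fun s => EfnT u s x)
      (EfnT u t x * (-(1 / 2) * (Dt u t x - 1 / Real.sqrt 2))) t :=
    ((hut.sub ((hasDerivAt_id t).div_const (Real.sqrt 2))).const_mul (-(1 / 2))).exp
  have hEx : HasDerivAt (fun s => EfnT u t s) (EfnT u t x * (-(1 / 2) * Dx u t x)) x :=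
    ((hux.sub_const (t / Real.sqrt 2)).const_mul (-(1 / 2))).exp
  have hθt : HasDerivAt (fun s => thetaT u v s x)
      ((1 / 2) * (-Dt v t x + 2 * (Real.exp (u t x) * Dt u t x) / Real.sqrt 2)) t :=
    (hvt.neg.add (((hut.exp.const_mul 2).const_add x).div_const (Real.sqrt 2))).const_mul (1 / 2)
  have hθx : HasDerivAt (fun s => thetaT u v t s)
      ((1 / 2) * (-Dx v t x + (1 + 2 * (Real.exp (u t x) * Dx u t x)) / Real.sqrt 2)) x :=
    (hvx.neg.add (((hasDerivAt_id x).add (hux.exp.const_mul 2)).div_const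
      (Real.sqrt 2))).const_mul (1 / 2)
  have hT := ((hEt.const_mul (-2)).mul hθt.cos).deriv
  have hX := ((hEx.const_mul (-2)).mul
    (((hux.exp.const_mul (Real.sqrt 2)).mul hθx.cos).sub hθx.sin)).deriv
  have hsq : Real.sqrt 2 ^ 2 = 2 := Real.sq_sqrt (by norm_num)
  have hinv : (Real.sqrt 2)⁻¹ = Real.sqrt 2 / 2 := by
    field_simp
    exact hsq.symm
  have hexp : Real.exp (2 * u t x) = Real.exp (u t x) ^ 2 := by
    rw [two_mul, Real.exp_add, sq]
  refine Eq.trans ?_ (congrArg₂ (· + ·) hT hX).symm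
  simp only [hexp, div_eq_mul_inv, hinv, Pi.sub_apply, Pi.mul_apply]
  generalize Real.sin (thetaT u v t x) = S, Real.cos (thetaT u v t x) = C, EfnT u t x = E,
    Real.exp (u t x) = e
  ring_nf
  simp only [hsq]
  ring
end
end

section
/- Let a, b : ℝ² → ℝ be C¹ functions of (û,v) satisfying a_v + b_û = 0 and a_û + b_v + a = 0 on ℝ². Then there exist C¹ functions S, R : ℝ² → ℝ with S_v = a, S_û + S = −b, R_û = −a, R_v = b, and for every pair of smooth functions u, v : ℝ² → ℝ of (t,x) with u > 0 everywhere, setting û = x + log u, the identity u·a(û,v)·(v_t − u^{−2}u_x − u^{−1}) + b(û,v)·(v_x − u_t) = D_t[u·S(û,v)] + D_x[R(û,v)] holds at every point of ℝ²; i.e., [Λ¹,Λ²] = [U·a(Û,V), b(Û,V)] with (a,b) solving the linear system a_V + b_Û = 0, a_Û + b_V + a = 0 are multipliers for conservation laws of the potential system v_t − u^{−2}u_x − u^{−1} = 0, v_x − u_t = 0. -/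
noncomputable section

/-- Partial derivative in the first argument of a function of two real variables. -/
def P1 (w : ℝ → ℝ → ℝ) (a b : ℝ) : ℝ := deriv (fun s => w s b) a

/-- Partial derivative in the second argument of a function of two real variables. -/
def P2 (w : ℝ → ℝ → ℝ) (a b : ℝ) : ℝ := deriv (fun s => w a s) b

open ContinuousLinearMap in
/-- Chain rule along a curve for a function of two real variables with given gradient. -/
lemma HasFDerivAt.hasDerivAt_curve {w : ℝ → ℝ → ℝ} {p q : ℝ → ℝ} {s c d p' q' : ℝ}
    (hw : HasFDerivAt (fun z : ℝ × ℝ => w z.1 z.2) (c • fst ℝ ℝ ℝ + d • snd ℝ ℝ ℝ) (p s, q s))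
    (hp : HasDerivAt p p' s) (hq : HasDerivAt q q' s) :
    HasDerivAt (fun r => w (p r) (q r)) (c * p' + d * q') s := by
  simpa [Function.comp_def] using hw.comp_hasDerivAt s (hp.prodMk hq)

open ContinuousLinearMap in
lemma HasFDerivAt.P1_eq {w : ℝ → ℝ → ℝ} {x y c d : ℝ}
    (hw : HasFDerivAt (fun z : ℝ × ℝ => w z.1 z.2) (c • fst ℝ ℝ ℝ + d • snd ℝ ℝ ℝ) (x, y)) :
    P1 w x y = c := by
  simpa [P1] using (hw.hasDerivAt_curve (p := id) (q := fun _ => y) (s := x)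
    (hasDerivAt_id x) (hasDerivAt_const x y)).deriv

open ContinuousLinearMap in
lemma HasFDerivAt.P2_eq {w : ℝ → ℝ → ℝ} {x y c d : ℝ}
    (hw : HasFDerivAt (fun z : ℝ × ℝ => w z.1 z.2) (c • fst ℝ ℝ ℝ + d • snd ℝ ℝ ℝ) (x, y)) :
    P2 w x y = d := by
  simpa [P2] using (hw.hasDerivAt_curve (p := fun _ => x) (q := id) (s := y)
    (hasDerivAt_const y x) (hasDerivAt_id y)).deriv

open ContinuousLinearMap in
/-- A differentiable function of two real variables has its partial derivatives as gradient. -/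
lemma DifferentiableAt.hasFDerivAt_partials {w : ℝ → ℝ → ℝ} {x y : ℝ}
    (hw : DifferentiableAt ℝ (fun z : ℝ × ℝ => w z.1 z.2) (x, y)) :
    HasFDerivAt (fun z : ℝ × ℝ => w z.1 z.2)
      (P1 w x y • fst ℝ ℝ ℝ + P2 w x y • snd ℝ ℝ ℝ) (x, y) := by
  obtain ⟨c, d, h⟩ : ∃ c d : ℝ, HasFDerivAt (fun z : ℝ × ℝ => w z.1 z.2)
      (c • fst ℝ ℝ ℝ + d • snd ℝ ℝ ℝ) (x, y) := by
    refine ⟨fderiv ℝ (fun z : ℝ × ℝ => w z.1 z.2) (x, y) (1, 0),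
      fderiv ℝ (fun z : ℝ × ℝ => w z.1 z.2) (x, y) (0, 1), ?_⟩
    convert! hw.hasFDerivAt using 1
    ext <;> simp
  rwa [h.P1_eq, h.P2_eq]

open ContinuousLinearMap in
/-- A closed `C¹` one-form `f dx + g dy` on the plane has a `C¹` potential. -/
lemma exists_potential {f g : ℝ → ℝ → ℝ}
    (hf : ContDiff ℝ 1 fun z : ℝ × ℝ => f z.1 z.2)
    (hg : ContDiff ℝ 1 fun z : ℝ × ℝ => g z.1 z.2)
    (hfg : ∀ x y, P2 f x y = P1 g x y) :
    ∃ F : ℝ → ℝ → ℝ, (ContDiff ℝ 1 fun z : ℝ × ℝ => F z.1 z.2) ∧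
      ∀ x y, HasFDerivAt (fun z : ℝ × ℝ => F z.1 z.2)
        (f x y • fst ℝ ℝ ℝ + g x y • snd ℝ ℝ ℝ) (x, y) := by
  set ω : ℝ × ℝ → ℝ × ℝ →L[ℝ] ℝ :=
    fun z => f z.1 z.2 • fst ℝ ℝ ℝ + g z.1 z.2 • snd ℝ ℝ ℝ
  have hωc : ContDiff ℝ 1 ω := (hf.smul contDiff_const).add (hg.smul contDiff_const)
  have hωd (z : ℝ × ℝ) := ((DifferentiableAt.hasFDerivAt_partials (hf.differentiable one_ne_zero z)).smul_const
    (fst ℝ ℝ ℝ)).add ((DifferentiableAt.hasFDerivAt_partials (hg.differentiable one_ne_zero z)).smul_const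
    (snd ℝ ℝ ℝ))
  obtain ⟨F, hF⟩ := convex_univ.exists_forall_hasFDerivAt_of_fderiv_symmetric isOpen_univ
    (hωc.differentiable one_ne_zero).differentiableOn (by
      intro z _ p q
      have h : fderiv ℝ ω z = _ := (hωd z).fderiv
      rw [h]
      simp [hfg]
      ring)
  refine ⟨fun x y => F (x, y), ?_, fun x y => hF (x, y) trivial⟩
  refine contDiff_one_iff_fderiv.2 ⟨fun z => (hF z trivial).differentiableAt, ?_⟩
  have : fderiv ℝ F = ω := funext fun z => (hF z trivial).fderiv
  simpa [this] using hωc.continuous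

/- STATEMENT 11: `[Λ¹,Λ²] = [U·a(Û,V), b(Û,V)]`, with `(a,b)` solving the linear
   system `a_V + b_Û = 0`, `a_Û + b_V + a = 0`, are multipliers for conservation
   laws of the potential system `v_t − u^{−2}u_x − u^{−1} = 0`, `v_x − u_t = 0`,
   with `Û = x + log u`. -/
theorem stmt11 (a b : ℝ → ℝ → ℝ)
    (ha : ContDiff ℝ 1 fun p : ℝ × ℝ => a p.1 p.2)
    (hb : ContDiff ℝ 1 fun p : ℝ × ℝ => b p.1 p.2)
    (h1 : ∀ uh v : ℝ, P2 a uh v + P1 b uh v = 0)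
    (h2 : ∀ uh v : ℝ, P1 a uh v + P2 b uh v + a uh v = 0) :
    ∃ S R : ℝ → ℝ → ℝ,
      (ContDiff ℝ 1 fun p : ℝ × ℝ => S p.1 p.2) ∧
      (ContDiff ℝ 1 fun p : ℝ × ℝ => R p.1 p.2) ∧
      (∀ uh v : ℝ, P2 S uh v = a uh v) ∧
      (∀ uh v : ℝ, P1 S uh v + S uh v = -b uh v) ∧
      (∀ uh v : ℝ, P1 R uh v = -a uh v) ∧
      (∀ uh v : ℝ, P2 R uh v = b uh v) ∧
      ∀ u v : ℝ → ℝ → ℝ,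
        ContDiff ℝ (⊤ : ℕ∞) (fun p : ℝ × ℝ => u p.1 p.2) →
        ContDiff ℝ (⊤ : ℕ∞) (fun p : ℝ × ℝ => v p.1 p.2) →
        (∀ t x : ℝ, 0 < u t x) →
        ∀ t x : ℝ,
          u t x * a (x + Real.log (u t x)) (v t x) *
            (Dt v t x - ((u t x) ^ 2)⁻¹ * Dx u t x - (u t x)⁻¹) +
          b (x + Real.log (u t x)) (v t x) * (Dx v t x - Dt u t x) =
          Dt (fun t x => u t x * S (x + Real.log (u t x)) (v t x)) t x +
          Dx (fun t x => R (x + Real.log (u t x)) (v t x)) t x := by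
  have hexp : ContDiff ℝ 1 fun z : ℝ × ℝ => Real.exp z.1 := contDiff_fst.exp
  have hda (x y : ℝ) := (DifferentiableAt.hasFDerivAt_partials (ha.differentiable one_ne_zero (x, y)))
  have hdb (x y : ℝ) := (DifferentiableAt.hasFDerivAt_partials (hb.differentiable one_ne_zero (x, y)))
  obtain ⟨R, hR, hdR⟩ := exists_potential (f := fun x y => -a x y) (g := b) ha.neg hb (by
    intro x y
    have : P2 (fun x y => -a x y) x y = -P2 a x y := by simp [P2]
    linarith [h1 x y])
  obtain ⟨T, hT, hdT⟩ := exists_potential (f := fun x y => -(Real.exp x * b x y))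
    (g := fun x y => Real.exp x * a x y) (hexp.mul hb).neg (hexp.mul ha) (by
    intro x y
    have hb' : P2 (fun x y => -(Real.exp x * b x y)) x y = -(Real.exp x * P2 b x y) := by
      simp [P2]
    have ha' : P1 (fun x y => Real.exp x * a x y) x y =
        Real.exp x * a x y + Real.exp x * P1 a x y := by
      have := (hda x y).hasDerivAt_curve (p := id) (q := fun _ => y) (s := x)
        (hasDerivAt_id x) (hasDerivAt_const x y)
      exact ((Real.hasDerivAt_exp x).mul (by simpa using this)).deriv
    rw [hb', ha']
    linear_combination -Real.exp x * h2 x y)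
  have hS : ContDiff ℝ 1 fun z : ℝ × ℝ => Real.exp (-z.1) * T z.1 z.2 :=
    contDiff_fst.neg.exp.mul hT
  obtain ⟨S, hST⟩ : ∃ S : ℝ → ℝ → ℝ, S = fun x y => Real.exp (-x) * T x y := ⟨_, rfl⟩
  have hdS (x y : ℝ) : HasFDerivAt (fun z : ℝ × ℝ => S z.1 z.2)
      ((-b x y - S x y) • ContinuousLinearMap.fst ℝ ℝ ℝ +
        a x y • ContinuousLinearMap.snd ℝ ℝ ℝ) (x, y) := by
    have he : HasFDerivAt (fun z : ℝ × ℝ => Real.exp (-z.1))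
      (Real.exp (-x) • -ContinuousLinearMap.fst ℝ ℝ ℝ) (x, y) :=
      (hasFDerivAt_fst (p := (x, y))).neg.exp
    have hxx : Real.exp (-x) * Real.exp x = 1 := by simp [← Real.exp_add]
    subst hST
    convert! he.mul (hdT x y) using 1
    ext
    · simp
      linear_combination b x y * hxx
    · simp
      linear_combination -a x y * hxx
  refine ⟨S, R, hST ▸ hS, hR, fun x y => (hdS x y).P2_eq, fun x y => ?_,
    fun x y => (hdR x y).P1_eq, fun x y => (hdR x y).P2_eq, ?_⟩
  · rw [(hdS x y).P1_eq]
    ring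
  intro u v hu hv hpos t x
  have hdu := (DifferentiableAt.hasFDerivAt_partials (hu.differentiable (by simp) (t, x)))
  have hdv := (DifferentiableAt.hasFDerivAt_partials (hv.differentiable (by simp) (t, x)))
  have hut : HasDerivAt (fun s => u s x) (Dt u t x) t := by
    simpa [Dt, P1] using hdu.hasDerivAt_curve (p := id) (q := fun _ => x) (s := t)
      (hasDerivAt_id t) (hasDerivAt_const t x)
  have hvt : HasDerivAt (fun s => v s x) (Dt v t x) t := by
    simpa [Dt, P1] using hdv.hasDerivAt_curve (p := id) (q := fun _ => x) (s := t)
      (hasDerivAt_id t) (hasDerivAt_const t x)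
  have hux : HasDerivAt (fun s => u t s) (Dx u t x) x := by
    simpa [Dx, P2] using hdu.hasDerivAt_curve (p := fun _ => t) (q := id) (s := x)
      (hasDerivAt_const x t) (hasDerivAt_id x)
  have hvx : HasDerivAt (fun s => v t s) (Dx v t x) x := by
    simpa [Dx, P2] using hdv.hasDerivAt_curve (p := fun _ => t) (q := id) (s := x)
      (hasDerivAt_const x t) (hasDerivAt_id x)
  have hu0 := (hpos t x).ne'
  have hSt := hut.mul ((hdS (x + Real.log (u t x)) (v t x)).hasDerivAt_curve
    (p := fun s => x + Real.log (u s x)) (q := fun s => v s x) (s := t)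
    ((hut.log hu0).const_add x) hvt)
  have hRx := (hdR (x + Real.log (u t x)) (v t x)).hasDerivAt_curve
    (p := fun s => s + Real.log (u t s)) (q := fun s => v t s) (s := x)
    ((hasDerivAt_id x).add (hux.log hu0)) hvx
  have e1 : Dt (fun t x => u t x * S (x + Real.log (u t x)) (v t x)) t x = _ := hSt.deriv
  have e2 : Dx (fun t x => R (x + Real.log (u t x)) (v t x)) t x = _ := hRx.deriv
  rw [e1, e2]
  field_simp
  ring
end
end

section
/- Let u, v : ℝ² → ℝ be smooth functions of (t,x). Then the identity t·e^x·(v_t − (sech²u)·u_x − tanh u) + (−e^x)·(v_x − u_t) = D_t[e^x·(tv + u)] + D_x[−e^x·(v + t·tanh u)] holds at every point of ℝ²; i.e., [α,β] = [te^x, −e^x] are multipliers yielding the conservation law with conserved densities [T,X] = [e^x(tv+u), −e^x(v + t·tanh u)] for the nonlinear telegraph potential system with F(u) = sech²u, G(u) = tanh u. -/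
noncomputable section

theorem Real.hasDerivAt_tanh_one_div_cosh_sq (y : ℝ) :
    HasDerivAt Real.tanh ((1 / Real.cosh y) ^ 2) y := by
  have hc : Real.cosh y ≠ 0 := (Real.cosh_pos y).ne'
  have h := (Real.hasDerivAt_sinh y).div (Real.hasDerivAt_cosh y) hc
  rw [show Real.tanh = Real.sinh / Real.cosh from funext Real.tanh_eq_sinh_div_cosh]
  refine h.congr_deriv ?_
  rw [← sq, ← sq, Real.cosh_sq_sub_sinh_sq, one_div_pow]

/- STATEMENT 12: `[α,β] = [t e^x, −e^x]` are multipliers yielding the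
   conservation law with densities `[T,X] = [e^x(tv+u), −e^x(v + t tanh u)]`
   for the NLT potential system with `F(u) = sech²u`, `G(u) = tanh u`. -/
theorem stmt12 (u v : ℝ → ℝ → ℝ)
    (hu : ContDiff ℝ (⊤ : ℕ∞) fun p : ℝ × ℝ => u p.1 p.2)
    (hv : ContDiff ℝ (⊤ : ℕ∞) fun p : ℝ × ℝ => v p.1 p.2) :
    ∀ t x : ℝ,
      t * Real.exp x *
        (Dt v t x - (1 / Real.cosh (u t x)) ^ 2 * Dx u t x - Real.tanh (u t x)) +
      (-Real.exp x) * (Dx v t x - Dt u t x) =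
      Dt (fun t x => Real.exp x * (t * v t x + u t x)) t x +
      Dx (fun t x => -Real.exp x * (v t x + t * Real.tanh (u t x))) t x := by
  intro t x
  have hu' := hu.differentiable (by simp)
  have hv' := hv.differentiable (by simp)
  have hT : Dt (fun t x => Real.exp x * (t * v t x + u t x)) t x =
      Real.exp x * (1 * v t x + t * Dt v t x + Dt u t x) :=
    ((((hasDerivAt_id t).mul (hasDerivAt_Dt hv' t x)).add
      (hasDerivAt_Dt hu' t x)).const_mul (Real.exp x)).deriv
  have hX : Dx (fun t x => -Real.exp x * (v t x + t * Real.tanh (u t x))) t x =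
      -Real.exp x * (v t x + t * Real.tanh (u t x)) +
        -Real.exp x * (Dx v t x + t * ((1 / Real.cosh (u t x)) ^ 2 * Dx u t x)) :=
    ((Real.hasDerivAt_exp x).neg.mul ((hasDerivAt_Dx hv' t x).add
      (((Real.hasDerivAt_tanh_one_div_cosh_sq (u t x)).comp x
        (hasDerivAt_Dx hu' t x)).const_mul t))).deriv
  rw [hT, hX]
  ring
end
end

section
/- Let F, G : ℝ → ℝ be differentiable and let c₁,…,c₅ ∈ ℝ satisfy, for all u ∈ ℝ: (c₃u + c₄)F'(u) − 2(c₁ − c₂ − G(u))F(u) = 0 and (c₃u + c₄)G'(u) + G(u)² − (c₁ − 2c₂ + c₃)G(u) − c₅ = 0. Let I : ℝ → ℝ be an antiderivative of F and define ξ(x,t,u,v) = c₁x + I(u), τ(x,t,u,v) = c₂t + v, η(x,t,u,v) = c₃u + c₄, φ(x,t,u,v) = c₅t + (c₁ − c₂ + c₃)v. Then (ξ,τ,η,φ) satisfies all eight determining equations for point symmetries of the nonlinear telegraph potential system with coefficients (F,G), identically in (x,t,u,v). In particular, since τ depends essentially on v, this point symmetry of the potential system yields a nonlocal symmetry of the nonlinear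 telegraph equation u_tt − (F(u)u_x)_x − (G(u))_x = 0. -/
noncomputable section

/-- Partial derivative in the first argument `x` of a function of `(x,t,u,v)`. -/
def pX (w : ℝ → ℝ → ℝ → ℝ → ℝ) (x t u v : ℝ) : ℝ := deriv (fun s => w s t u v) x

/-- Partial derivative in the second argument `t`. -/
def pT (w : ℝ → ℝ → ℝ → ℝ → ℝ) (x t u v : ℝ) : ℝ := deriv (fun s => w x s u v) t

/-- Partial derivative in the third argument `u`. -/
def pU (w : ℝ → ℝ → ℝ → ℝ → ℝ) (x t u v : ℝ) : ℝ := deriv (fun s => w x t s v) u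

/-- Partial derivative in the fourth argument `v`. -/
def pV (w : ℝ → ℝ → ℝ → ℝ → ℝ) (x t u v : ℝ) : ℝ := deriv (fun s => w x t u s) v

/-- The eight determining equations for a point symmetry
`X = ξ∂/∂x + τ∂/∂t + η∂/∂u + φ∂/∂v` of the nonlinear telegraph potential system
`v_t − F(u)u_x − G(u) = 0`, `v_x − u_t = 0`, holding for all `(x,t,u,v) ∈ ℝ⁴`. -/
def DetEqs (F G : ℝ → ℝ) (ξ τ η φ : ℝ → ℝ → ℝ → ℝ → ℝ) : Prop :=
  ∀ x t u v : ℝ,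
    pV ξ x t u v - pU τ x t u v = 0 ∧
    pU η x t u v - pV φ x t u v + pX ξ x t u v - pT τ x t u v = 0 ∧
    G u * (pV η x t u v + pX τ x t u v) + pT η x t u v - pX φ x t u v = 0 ∧
    pU ξ x t u v - F u * pV τ x t u v = 0 ∧
    pU φ x t u v - G u * pU τ x t u v - F u * pV η x t u v = 0 ∧
    G u * pV ξ x t u v + pT ξ x t u v - F u * pX τ x t u v = 0 ∧
    F u * (pV φ x t u v - pT τ x t u v + pX ξ x t u v - pU η x t u v -
      2 * G u * pV τ x t u v) - deriv F u * η x t u v = 0 ∧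
    G u * (pV φ x t u v - pT τ x t u v - G u * pV τ x t u v) -
      F u * pX η x t u v - deriv G u * η x t u v + pT φ x t u v = 0

/- STATEMENT 16: for any `(F,G)` pair satisfying the ODE system (43), the given
   `(ξ,τ,η,φ)` satisfies all eight determining equations for point symmetries of
   the NLT potential system; moreover `τ` depends essentially on `v` (so this
   point symmetry of the potential system is a nonlocal symmetry of the NLT
   equation). -/
theorem stmt16 (F G : ℝ → ℝ) (hF : Differentiable ℝ F) (hG : Differentiable ℝ G)
    (c₁ c₂ c₃ c₄ c₅ : ℝ)
    (hode1 : ∀ u : ℝ,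
      (c₃ * u + c₄) * deriv F u - 2 * (c₁ - c₂ - G u) * F u = 0)
    (hode2 : ∀ u : ℝ,
      (c₃ * u + c₄) * deriv G u + (G u) ^ 2 - (c₁ - 2 * c₂ + c₃) * G u - c₅ = 0)
    (I : ℝ → ℝ) (hI : ∀ s : ℝ, HasDerivAt I (F s) s) :
    DetEqs F G
      (fun x _t u _v => c₁ * x + I u)
      (fun _x t _u v => c₂ * t + v)
      (fun _x _t u _v => c₃ * u + c₄)
      (fun _x t _u v => c₅ * t + (c₁ - c₂ + c₃) * v) ∧
    ∀ x t u v : ℝ, pV (fun _x t _u v => c₂ * t + v) x t u v ≠ 0 := by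
  have dlin (a b s : ℝ) : deriv (fun y => a * y + b) s = a := by simp
  have dlin' (a b s : ℝ) : deriv (fun y => b + a * y) s = a := by simp
  have dshift (b s : ℝ) : deriv (fun y => b + y) s = 1 :=
    ((hasDerivAt_id s).const_add b).deriv
  have dI (b s : ℝ) : deriv (fun y => b + I y) s = F s := ((hI s).const_add b).deriv
  refine ⟨fun x t u v => ?_, fun x t u v => ?_⟩
  · simp only [pX, pT, pU, pV, dlin, dlin', dshift, dI, deriv_const]
    refine ⟨?_, ?_, ?_, ?_, ?_, ?_, ?_, ?_⟩
    iterate 6 ring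
    · linear_combination -hode1 u
    · linear_combination -hode2 u
  · simp only [pV, dshift]
    exact one_ne_zero
end
end

section
/- Let F : ℝ → ℝ be continuous and let a, b : ℝ² → ℝ be C¹ functions of (U,V) satisfying the linear system b_V + a_U = 0 and b_U + F(U)·a_V = 0 on ℝ². Then there exist C¹ functions T, X : ℝ² → ℝ with T_U = −b, T_V = a, X_U = −a·F, X_V = b, and for every pair of smooth functions u, v : ℝ² → ℝ of (t,x) the identity a(u,v)·(v_t − F(u)·u_x) + b(u,v)·(v_x − u_t) = D_t[T(u,v)] + D_x[X(u,v)] holds at every point of ℝ²; i.e., every solution [Λ¹,Λ²] = [a(U,V), b(U,V)] of the linear system (which is the adjoint of the symmetry-determining system A_u − F(u)B_v = 0, A_v − B_u = 0) is a set of multipliers for a conservation law of the quasilinear potential system v_t − F(u)u_x = 0, v_x − u_t = 0. -/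
noncomputable section

open Set Filter Topology MeasureTheory in
/-- Differentiation under the integral sign for an integrand with continuous partial derivative. -/
theorem hasDerivAt_intervalIntegral_param {f k : ℝ → ℝ → ℝ}
    (hf : Continuous fun p : ℝ × ℝ => f p.1 p.2) (hk : Continuous fun p : ℝ × ℝ => k p.1 p.2)
    (hfk : ∀ U V, HasDerivAt (fun s => f s V) (k U V) U) (c d U : ℝ) :
    HasDerivAt (fun U => ∫ s in c..d, f U s) (∫ s in c..d, k U s) U := by
  obtain ⟨C, hC⟩ := ((isCompact_closedBall U 1).prod (isCompact_uIcc (a := c) (b := d))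
    ).exists_bound_of_continuousOn hk.continuousOn
  have hslice (h : ℝ → ℝ → ℝ) (hh : Continuous fun p : ℝ × ℝ => h p.1 p.2) (r : ℝ) :
      Continuous (h r) := hh.comp (Continuous.prodMk_right r)
  exact (intervalIntegral.hasDerivAt_integral_of_dominated_loc_of_deriv_le
    (bound := fun _ => C) (Metric.closedBall_mem_nhds U one_pos)
    (.of_forall fun r => (hslice f hf r).aestronglyMeasurable)
    ((hslice f hf U).intervalIntegrable _ _)
    (hslice k hk U).aestronglyMeasurable
    (.of_forall fun t ht r hr => hC (r, t) ⟨hr, uIoc_subset_uIcc ht⟩)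
    intervalIntegrable_const
    (.of_forall fun t _ r _ => hfk r t)).2

/-- A continuous closed form `g dU + f dV` on the plane has a `C¹` primitive; closedness
`f_U = k = g_V` only involves the partial derivatives that appear in it. -/
theorem exists_contDiff_primitive {f g k : ℝ → ℝ → ℝ}
    (hf : Continuous fun p : ℝ × ℝ => f p.1 p.2) (hg : Continuous fun p : ℝ × ℝ => g p.1 p.2)
    (hk : Continuous fun p : ℝ × ℝ => k p.1 p.2)
    (hfk : ∀ U V, HasDerivAt (fun s => f s V) (k U V) U)
    (hgk : ∀ U V, HasDerivAt (fun s => g U s) (k U V) V) :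
    ∃ H : ℝ → ℝ → ℝ, (ContDiff ℝ 1 fun p : ℝ × ℝ => H p.1 p.2) ∧
      (∀ U V, HasDerivAt (fun s => H s V) (g U V) U) ∧
      (∀ U V, HasDerivAt (fun s => H U s) (f U V) V) := by
  let H : ℝ → ℝ → ℝ := fun U V => (∫ s in (0 : ℝ)..V, f U s) + ∫ s in (0 : ℝ)..U, g s 0
  have hU (U V) : HasDerivAt (fun s => H s V) (g U V) U := by
    have hint : ∫ s in (0 : ℝ)..V, k U s = g U V - g U 0 :=
      intervalIntegral.integral_eq_sub_of_hasDerivAt (fun s _ => hgk U s)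
        ((hk.comp (Continuous.prodMk_right U)).intervalIntegrable _ _)
    refine ((hasDerivAt_intervalIntegral_param hf hk hfk 0 V U).add
      ((hg.comp (Continuous.prodMk_left (0 : ℝ))).integral_hasStrictDerivAt 0 U).hasDerivAt
      ).congr_deriv ?_
    simp [hint]
  have hV (U V) : HasDerivAt (fun s => H U s) (f U V) V :=
    ((hf.comp (Continuous.prodMk_right U)).integral_hasStrictDerivAt 0 V).hasDerivAt.add_const _
  refine ⟨H, ?_, hU, hV⟩
  let T : ℝ →L[ℝ] ℝ →L[ℝ] ℝ := ContinuousLinearMap.toSpanSingletonCLE.toContinuousLinearMap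
  have hT {h : ℝ → ℝ → ℝ} (hh : Continuous fun p : ℝ × ℝ => h p.1 p.2) :
      Continuous fun p : ℝ × ℝ => ContinuousLinearMap.toSpanSingleton ℝ (h p.1 p.2) :=
    T.continuous.comp hh
  refine contDiff_one_iff_hasFDerivAt.2 ⟨fun p =>
    (ContinuousLinearMap.toSpanSingleton ℝ (g p.1 p.2)).coprod
      (ContinuousLinearMap.toSpanSingleton ℝ (f p.1 p.2)), ?_, fun p => ?_⟩
  · exact (ContinuousLinearMap.coprodEquivL ℝ).continuous.comp ((hT hg).prodMk (hT hf))
  · exact (hasStrictFDerivAt_uncurry_coprod (f := H)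
      (f₁ := fun U V => ContinuousLinearMap.toSpanSingleton ℝ (g U V))
      (f₂ := fun U V => ContinuousLinearMap.toSpanSingleton ℝ (f U V))
      (.of_forall fun q => (hU q.1 q.2).hasFDerivAt) (.of_forall fun q => (hV q.1 q.2).hasFDerivAt)
      (hT hg).continuousAt (hT hf).continuousAt).hasFDerivAt

section Partial

variable {w : ℝ → ℝ → ℝ}

theorem hasDerivAt_left (hw : Differentiable ℝ fun p : ℝ × ℝ => w p.1 p.2) (U V : ℝ) :
    HasDerivAt (fun s => w s V) (P1 w U V) U :=
  (hw.comp (differentiable_id.prodMk (differentiable_const V)) U).hasDerivAt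

theorem hasDerivAt_right (hw : Differentiable ℝ fun p : ℝ × ℝ => w p.1 p.2) (U V : ℝ) :
    HasDerivAt (fun s => w U s) (P2 w U V) V :=
  (hw.comp ((differentiable_const U).prodMk differentiable_id) V).hasDerivAt

theorem P1_eq_fderiv (hw : Differentiable ℝ fun p : ℝ × ℝ => w p.1 p.2) (U V : ℝ) :
    P1 w U V = fderiv ℝ (fun p : ℝ × ℝ => w p.1 p.2) (U, V) (1, 0) :=
  ((hw (U, V)).hasFDerivAt.comp_hasDerivAt (f := fun s => (s, V)) U
    ((hasDerivAt_id U).prodMk (hasDerivAt_const U V))).deriv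

theorem P2_eq_fderiv (hw : Differentiable ℝ fun p : ℝ × ℝ => w p.1 p.2) (U V : ℝ) :
    P2 w U V = fderiv ℝ (fun p : ℝ × ℝ => w p.1 p.2) (U, V) (0, 1) :=
  ((hw (U, V)).hasFDerivAt.comp_hasDerivAt (f := fun s => (U, s)) V
    ((hasDerivAt_const V U).prodMk (hasDerivAt_id V))).deriv

theorem continuous_P1 (hw : ContDiff ℝ 1 fun p : ℝ × ℝ => w p.1 p.2) :
    Continuous fun p : ℝ × ℝ => P1 w p.1 p.2 := by
  simp only [P1_eq_fderiv (hw.differentiable one_ne_zero)]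
  exact (hw.continuous_fderiv one_ne_zero).clm_apply continuous_const

theorem hasDerivAt_comp₂ (hw : Differentiable ℝ fun p : ℝ × ℝ => w p.1 p.2)
    {y z : ℝ → ℝ} {y' z' r : ℝ} (hy : HasDerivAt y y' r) (hz : HasDerivAt z z' r) :
    HasDerivAt (fun s => w (y s) (z s)) (P1 w (y r) (z r) * y' + P2 w (y r) (z r) * z') r := by
  refine ((hw (y r, z r)).hasFDerivAt.comp_hasDerivAt r (hy.prodMk hz)).congr_deriv ?_
  have e : (y', z') = y' • ((1 : ℝ), (0 : ℝ)) + z' • ((0 : ℝ), (1 : ℝ)) := by simp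
  rw [e, map_add, map_smul, map_smul, P1_eq_fderiv hw, P2_eq_fderiv hw]
  simp [mul_comm]

end Partial

/- STATEMENT 19: every solution `[Λ¹,Λ²] = [a(U,V), b(U,V)]` of the linear
   system `b_V + a_U = 0`, `b_U + F(U)a_V = 0` (the adjoint of the
   symmetry-determining system) is a set of multipliers for a conservation law
   of the quasilinear potential system `v_t − F(u)u_x = 0`, `v_x − u_t = 0`. -/
theorem stmt19 (F : ℝ → ℝ) (hF : Continuous F) (a b : ℝ → ℝ → ℝ)
    (ha : ContDiff ℝ 1 fun p : ℝ × ℝ => a p.1 p.2)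
    (hb : ContDiff ℝ 1 fun p : ℝ × ℝ => b p.1 p.2)
    (h1 : ∀ U V : ℝ, P2 b U V + P1 a U V = 0)
    (h2 : ∀ U V : ℝ, P1 b U V + F U * P2 a U V = 0) :
    ∃ T X : ℝ → ℝ → ℝ,
      (ContDiff ℝ 1 fun p : ℝ × ℝ => T p.1 p.2) ∧
      (ContDiff ℝ 1 fun p : ℝ × ℝ => X p.1 p.2) ∧
      (∀ U V : ℝ, P1 T U V = -b U V) ∧
      (∀ U V : ℝ, P2 T U V = a U V) ∧
      (∀ U V : ℝ, P1 X U V = -(a U V * F U)) ∧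
      (∀ U V : ℝ, P2 X U V = b U V) ∧
      ∀ u v : ℝ → ℝ → ℝ,
        ContDiff ℝ (⊤ : ℕ∞) (fun p : ℝ × ℝ => u p.1 p.2) →
        ContDiff ℝ (⊤ : ℕ∞) (fun p : ℝ × ℝ => v p.1 p.2) →
        ∀ t x : ℝ,
          a (u t x) (v t x) * (Dt v t x - F (u t x) * Dx u t x) +
          b (u t x) (v t x) * (Dx v t x - Dt u t x) =
          Dt (fun t x => T (u t x) (v t x)) t x +
          Dx (fun t x => X (u t x) (v t x)) t x := by
  have ha' := ha.differentiable one_ne_zero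
  have hb' := hb.differentiable one_ne_zero
  obtain ⟨T, hT, hTU, hTV⟩ := exists_contDiff_primitive (f := a) (g := fun U V => -b U V)
    ha.continuous hb.continuous.neg (continuous_P1 ha) (hasDerivAt_left ha') fun U V => by
      refine (hasDerivAt_right hb' U V).neg.congr_deriv ?_
      linarith [h1 U V]
  obtain ⟨X, hX, hXU, hXV⟩ := exists_contDiff_primitive (f := b) (g := fun U V => -(a U V * F U))
    hb.continuous (ha.continuous.mul (hF.comp continuous_fst)).neg (continuous_P1 hb)
    (hasDerivAt_left hb') fun U V => by
      refine ((hasDerivAt_right ha' U V).mul_const (F U)).neg.congr_deriv ?_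
      linarith [h2 U V]
  have hT1 (U V) : P1 T U V = -b U V := (hTU U V).deriv
  have hT2 (U V) : P2 T U V = a U V := (hTV U V).deriv
  have hX1 (U V) : P1 X U V = -(a U V * F U) := (hXU U V).deriv
  have hX2 (U V) : P2 X U V = b U V := (hXV U V).deriv
  refine ⟨T, X, hT, hX, hT1, hT2, hX1, hX2, fun u v hu hv t x => ?_⟩
  have hu' := hu.differentiable (by simp)
  have hv' := hv.differentiable (by simp)
  have ht : Dt (fun t x => T (u t x) (v t x)) t x =
      P1 T (u t x) (v t x) * Dt u t x + P2 T (u t x) (v t x) * Dt v t x :=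
    (hasDerivAt_comp₂ (hT.differentiable one_ne_zero) (hasDerivAt_left hu' t x)
      (hasDerivAt_left hv' t x)).deriv
  have hx : Dx (fun t x => X (u t x) (v t x)) t x =
      P1 X (u t x) (v t x) * Dx u t x + P2 X (u t x) (v t x) * Dx v t x :=
    (hasDerivAt_comp₂ (hX.differentiable one_ne_zero) (hasDerivAt_right hu' t x)
      (hasDerivAt_right hv' t x)).deriv
  rw [ht, hx, hT1, hT2, hX1, hX2]
  ring
end
end
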